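/- Let μ be a positive finite Borel measure on (0,1), let 1 ≤ p < ∞, and let α, β > -1 with β - α > -1. If H_μ^{α,β} : l^p_{w₁} → l^p_{w₂} is bounded, then C_μ(β,p) = ∫_{(0,1)} (1-t)^{-(1-1/p)(β+1)} t^{-(β+1)/p} dμ(t) is finite and the operator norm of H_μ^{α,β} is at least C_μ(β,p). -/

import Mathlib

open MeasureTheory Set

/-- `(γ+1)_s = Γ(γ+s+1)/Γ(γ+1)`. -/
noncomputable def poch (γ s : ℝ) : ℝ := Real.Gamma (γ + s + 1) / Real.Gamma (γ + 1)

/-- `k_{α,β}(m,n) = Γ(n+m+β+1)/(Γ(m+α+1)Γ(n+β-α+1))`. -/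
noncomputable def kker (α β : ℝ) (m n : ℕ) : ℝ :=
  Real.Gamma ((n : ℝ) + (m : ℝ) + β + 1) /
    (Real.Gamma ((m : ℝ) + α + 1) * Real.Gamma ((n : ℝ) + β - α + 1))

/-- The operator `H_μ^{α,β}(a)(n) = ∑_m ∫_{(0,1)} k_{α,β}(m,n) t^m (1-t)^n a_m dμ(t)`. -/
noncomputable def Hab (μ : Measure ℝ) (α β : ℝ) (a : ℕ → ℂ) (n : ℕ) : ℂ :=
  ∑' m : ℕ, ∫ t in Ioo (0 : ℝ) 1, (kker α β m n * t ^ m * (1 - t) ^ n) • a m ∂μ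

/-- The weight `w₁(m) = (m+1)_α^{-p} (m+1)_β`. -/
noncomputable def w1 (α β p : ℝ) (m : ℕ) : ℝ := (poch (m : ℝ) α) ^ (-p) * poch (m : ℝ) β

/-- The weight `w₂(m) = (m+β-α+1)_α^{-p} (m+1)_β`. -/
noncomputable def w2 (α β p : ℝ) (m : ℕ) : ℝ :=
  (poch ((m : ℝ) + β - α) α) ^ (-p) * poch (m : ℝ) β

open Filter Topology ENNReal

/-- The negative binomial coefficient `Γ(m+r)/(m! Γ(r))`. -/
noncomputable def nbc (r : ℝ) (m : ℕ) : ℝ :=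
  Real.Gamma ((m : ℝ) + r) / (m.factorial * Real.Gamma r)

lemma nbc_pos {r : ℝ} (hr : 0 < r) (m : ℕ) : 0 < nbc r m := by
  unfold nbc
  have h1 : 0 < Real.Gamma ((m : ℝ) + r) := Real.Gamma_pos_of_pos (by positivity)
  have h2 : 0 < Real.Gamma r := Real.Gamma_pos_of_pos hr
  positivity

lemma nbc_succ {r : ℝ} (hr : 0 < r) (m : ℕ) :
    ((m : ℝ) + 1) * nbc r (m + 1) = (m + r) * nbc r m := by
  unfold nbc
  have h2 : 0 < Real.Gamma r := Real.Gamma_pos_of_pos hr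
  have h3 : Real.Gamma (((m + 1 : ℕ) : ℝ) + r) = (m + r) * Real.Gamma (m + r) := by
    rw [← Real.Gamma_add_one (by positivity)]
    congr 1
    push_cast
    ring
  rw [h3, Nat.factorial_succ]
  push_cast
  field_simp

lemma nbc_succ' {r : ℝ} (hr : 0 < r) (m : ℕ) :
    ((m : ℝ) + 1) * nbc r (m + 1) = r * nbc (r + 1) m := by
  unfold nbc
  have h2 : 0 < Real.Gamma r := Real.Gamma_pos_of_pos hr
  have h3 : Real.Gamma (((m + 1 : ℕ) : ℝ) + r) = Real.Gamma (m + (r + 1)) := by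
    congr 1
    push_cast
    ring
  rw [h3, Nat.factorial_succ, Real.Gamma_add_one hr.ne']
  push_cast
  field_simp

lemma multichoose_eq_nbc {r : ℝ} (hr : 0 < r) (m : ℕ) :
    Ring.choose (r + m - 1) m = nbc r m := by
  rw [← Ring.multichoose_eq]
  have h := Ring.factorial_nsmul_multichoose_eq_ascPochhammer r m
  rw [Polynomial.ascPochhammer_smeval_eq_eval] at h
  have h2 : (ascPochhammer ℝ m).eval r = m.factorial * nbc r m := by
    clear h
    induction m with
    | zero => 
      have h2 : 0 < Real.Gamma r := Real.Gamma_pos_of_pos hr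
      simp [nbc, h2.ne']
    | succ k ih =>
      rw [ascPochhammer_succ_eval, ih, Nat.factorial_succ]
      have := nbc_succ hr k
      push_cast
      linear_combination (-(k.factorial : ℝ)) * this
  rw [h2, nsmul_eq_mul] at h
  exact mul_left_cancel₀ (by positivity) h

lemma hasSum_nbc {r t : ℝ} (hr : 0 < r) (ht0 : 0 < t) (ht1 : t < 1) :
    HasSum (fun m : ℕ => nbc r m * t ^ m) ((1 - t) ^ (-r)) := by
  have h := (Real.one_div_one_sub_rpow_hasFPowerSeriesOnBall_zero r).hasSum (y := t)
    (by simp [abs_of_pos ht0, ht1, enorm_eq_nnnorm, ← NNReal.coe_lt_coe])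
  simp only [FormalMultilinearSeries.ofScalars_apply_eq, multichoose_eq_nbc hr, zero_add] at h
  rw [Real.rpow_neg (by linarith)]
  simpa [smul_eq_mul] using h

lemma hasSum_mul_nbc {r t : ℝ} (hr : 0 < r) (ht0 : 0 < t) (ht1 : t < 1) :
    HasSum (fun m : ℕ => (m : ℝ) * (nbc r m * t ^ m)) (r * t * (1 - t) ^ (-(r + 1))) := by
  have h := (hasSum_nbc (r := r + 1) (by linarith) ht0 ht1).mul_left (r * t)
  rw [← hasSum_nat_add_iff' 1]
  simp only [Finset.range_one, Finset.sum_singleton, Nat.cast_zero, zero_mul, sub_zero]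
  refine h.congr_fun ?_
  intro m
  have := nbc_succ' hr m
  push_cast
  rw [pow_succ]
  linear_combination (t ^ m * t) * this

lemma tangent_rpow {u v s : ℝ} (hu : 0 < u) (hv : 0 < v) (hs : 0 < s) :
    v ^ (-s) * (1 + s) - s * v ^ (-s) / v * u ≤ u ^ (-s) := by
  have h1 : u ^ (-s) = v ^ (-s) * (u / v) ^ (-s) := by
    rw [← Real.mul_rpow hv.le (by positivity)]
    congr 1
    field_simp
  have h2 : 1 - s * (u / v - 1) ≤ (u / v) ^ (-s) := by
    rw [Real.rpow_def_of_pos (by positivity)]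
    have a := Real.add_one_le_exp (Real.log (u / v) * -s)
    have b := Real.log_le_sub_one_of_pos (show 0 < u / v by positivity)
    nlinarith
  rw [h1]
  have h3 := mul_le_mul_of_nonneg_left h2 (Real.rpow_nonneg hv.le (-s))
  refine le_trans (le_of_eq ?_) h3
  field_simp
  ring

/-- Jensen's inequality for the negative binomial distribution. -/
lemma jensen_nbc {c t s : ℝ} (n : ℕ) (hc : 0 < c) (ht0 : 0 < t) (ht1 : t < 1) (hs : 0 < s) :
    ENNReal.ofReal ((1 - t) ^ (s - c) * (n * t + c) ^ (-s)) ≤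
      ∑' m : ℕ, ENNReal.ofReal (nbc (n + c) m * (m + c) ^ (-s) * (t ^ m * (1 - t) ^ n)) := by
  have ht : 0 < 1 - t := by linarith
  have hr : 0 < n + c := by positivity
  set r := (n : ℝ) + c with hrdef
  set v := (n * t + c) / (1 - t) with hv
  have hv0 : 0 < v := by positivity
  have hS0 := hasSum_nbc hr ht0 ht1
  have hS1 := hasSum_mul_nbc hr ht0 ht1
  have hnn : ∀ m : ℕ, 0 ≤ nbc r m * (m + c) ^ (-s) * (t ^ m * (1 - t) ^ n) := by
    intro m
    have := nbc_pos hr m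
    positivity
  have hsum : Summable (fun m : ℕ => nbc r m * (m + c) ^ (-s) * (t ^ m * (1 - t) ^ n)) := by
    refine Summable.of_nonneg_of_le hnn ?_ (hS0.summable.mul_left (c ^ (-s) * (1 - t) ^ n))
    intro m
    have h1 : ((m : ℝ) + c) ^ (-s) ≤ c ^ (-s) :=
      Real.rpow_le_rpow_of_nonpos hc (by linarith [(Nat.cast_nonneg m : (0 : ℝ) ≤ m)]) (by linarith)
    have := nbc_pos hr m
    calc _ = (nbc r m * (t ^ m * (1 - t) ^ n)) * (m + c) ^ (-s) := by ring
      _ ≤ (nbc r m * (t ^ m * (1 - t) ^ n)) * c ^ (-s) := by gcongr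
      _ = _ := by ring
  rw [← ENNReal.ofReal_tsum_of_nonneg hnn hsum]
  apply ENNReal.ofReal_le_ofReal
  have hL := ((hS0.mul_left (v ^ (-s) * (1 + s) - s * v ^ (-s) / v * c)).sub
    (hS1.mul_left (s * v ^ (-s) / v))).mul_left ((1 - t) ^ n)
  refine le_trans (le_of_eq ?_) (hL.tsum_eq ▸ hL.summable.tsum_le_tsum ?_ hsum)
  · have e1 : (1 - t) ^ (-(r + 1)) = (1 - t) ^ (-r) / (1 - t) := by
      rw [neg_add, Real.rpow_add ht, Real.rpow_neg_one]; rfl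
    have e2 : v ^ (-s) = (n * t + c) ^ (-s) * (1 - t) ^ s := by
      rw [hv, Real.div_rpow (by positivity) ht.le, Real.rpow_neg ht.le, div_inv_eq_mul]
    have e3 : (1 - t) ^ (s - c) = (1 - t) ^ n * (1 - t) ^ (-r) * (1 - t) ^ s := by
      rw [← Real.rpow_natCast, ← Real.rpow_add ht, ← Real.rpow_add ht]
      congr 1
      rw [hrdef]; ring
    have e4 : c + r * t / (1 - t) = v := by
      rw [hv, hrdef]; field_simp; ring
    calc _ = (1 - t) ^ n * (1 - t) ^ (-r) * v ^ (-s) := by rw [e3, e2]; ring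
      _ = (1 - t) ^ n * (1 - t) ^ (-r) * (v ^ (-s) * (1 + s) - s * v ^ (-s) / v * v) := by
        field_simp; ring
      _ = (1 - t) ^ n * (1 - t) ^ (-r) * (v ^ (-s) * (1 + s) - s * v ^ (-s) / v * (c + r * t / (1 - t))) := by
        rw [e4]
      _ = _ := by rw [e1]; ring
  · intro m
    have h := tangent_rpow (u := m + c) (v := v) (s := s) (by positivity) hv0 hs
    have := nbc_pos hr m
    have h' := mul_le_mul_of_nonneg_left h (show 0 ≤ nbc r m * (t ^ m * (1 - t) ^ n) by positivity)
    calc _ = _ := ?_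
      _ ≤ _ := h'
      _ = _ := by ring
    ring

/-- The weight `Γ(n+c)/n!`. -/
noncomputable def Wc (c : ℝ) (n : ℕ) : ℝ := Real.Gamma ((n : ℝ) + c) / n.factorial

lemma Wc_pos {c : ℝ} (hc : 0 < c) (n : ℕ) : 0 < Wc c n := by
  unfold Wc
  have h1 : 0 < Real.Gamma ((n : ℝ) + c) := Real.Gamma_pos_of_pos (by positivity)
  positivity

lemma prod_eq_Gamma {c : ℝ} (hc : 0 < c) (n : ℕ) :
    (∏ j ∈ Finset.range n, (c + j)) * Real.Gamma c = Real.Gamma (n + c) := by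
  induction n with
  | zero => simp
  | succ k ih =>
    have h3 : Real.Gamma (((k + 1 : ℕ) : ℝ) + c) = (k + c) * Real.Gamma (k + c) := by
      rw [← Real.Gamma_add_one (by positivity)]
      congr 1
      push_cast
      ring
    rw [Finset.prod_range_succ, h3, ← ih]
    ring

lemma Wc_asymp {c : ℝ} (hc : 0 < c) :
    Tendsto (fun n : ℕ => Wc c n * ((n : ℝ) + c) ^ (-c) * (n + c)) atTop (𝓝 1) := by
  have hG : 0 < Real.Gamma c := Real.Gamma_pos_of_pos hc
  have h1 := (Real.GammaSeq_tendsto_Gamma c).inv₀ hG.ne'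
  have h2 : Tendsto (fun n : ℕ => (n : ℝ) / (n + c)) atTop (𝓝 1) :=
    tendsto_natCast_div_add_atTop c
  have h3 := (h2.rpow_const (p := c) (Or.inl one_ne_zero))
  have h4 := ((h1.const_mul (Real.Gamma c)).mul h3)
  rw [Real.one_rpow, mul_one, mul_inv_cancel₀ hG.ne'] at h4
  refine h4.congr' ?_
  filter_upwards [eventually_ge_atTop 1] with n hn
  have hn0 : (0 : ℝ) < n := by exact_mod_cast hn
  have hp := prod_eq_Gamma hc (n + 1)
  have hg : Real.Gamma (((n + 1 : ℕ) : ℝ) + c) = (n + c) * Real.Gamma (n + c) := by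
    rw [← Real.Gamma_add_one (by positivity)]
    congr 1
    push_cast
    ring
  rw [hg] at hp
  have hP : (∏ j ∈ Finset.range (n + 1), (c + (j : ℝ))) =
      (n + c) * Real.Gamma (n + c) / Real.Gamma c := by
    rw [← hp]; field_simp
  have h5 : 0 < Real.Gamma ((n : ℝ) + c) := Real.Gamma_pos_of_pos (by positivity)
  rw [Real.GammaSeq, hP, Wc, Real.div_rpow hn0.le (by positivity), Real.rpow_neg (by positivity)]
  have h6 : 0 < (n : ℝ) ^ c := by positivity
  have h7 : 0 < ((n : ℝ) + c) ^ c := by positivity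
  have h8 : (0 : ℝ) < (n : ℝ) + c := by positivity
  field_simp

lemma Wc_term {c δ : ℝ} (hc : 0 < c) (n : ℕ) :
    Wc c n * ((n : ℝ) + c) ^ (-(c + δ)) =
      (Wc c n * ((n : ℝ) + c) ^ (-c) * (n + c)) * (1 / |(n : ℝ) + c| ^ (1 + δ)) := by
  have h8 : (0 : ℝ) < (n : ℝ) + c := by positivity
  rw [abs_of_pos h8, one_div, ← Real.rpow_neg h8.le, show -(c + δ) = -c + 1 + -(1 + δ) by ring,
    Real.rpow_add h8, Real.rpow_add h8, Real.rpow_one]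
  ring

lemma summable_Wc {c δ : ℝ} (hc : 0 < c) (hδ : 0 < δ) :
    Summable (fun n : ℕ => Wc c n * ((n : ℝ) + c) ^ (-(c + δ))) := by
  have h := (Real.summable_one_div_nat_add_rpow c (1 + δ)).2 (by linarith)
  refine summable_of_isBigO_nat h ?_
  simp_rw [Wc_term hc]
  have h1 := (Wc_asymp hc).isBigO_one ℝ
  simpa using! h1.mul (Asymptotics.isBigO_refl (fun n : ℕ => 1 / |(n : ℝ) + c| ^ (1 + δ)) atTop)

lemma not_summable_Wc {c : ℝ} (hc : 0 < c) :
    ¬ Summable (fun n : ℕ => Wc c n * ((n : ℝ) + c) ^ (-c)) := by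
  intro hs
  have h : ¬ Summable (fun n : ℕ => 1 / |(n : ℝ) + c| ^ (1 : ℝ)) :=
    fun h => lt_irrefl _ ((Real.summable_one_div_nat_add_rpow c 1).1 h)
  apply h
  have e : ∀ n : ℕ, 1 / |(n : ℝ) + c| ^ (1 : ℝ) =
      (Wc c n * ((n : ℝ) + c) ^ (-c) * (n + c))⁻¹ * (Wc c n * ((n : ℝ) + c) ^ (-c)) := by
    intro n
    have h8 : (0 : ℝ) < (n : ℝ) + c := by positivity
    have h9 := Wc_pos hc n
    have h10 : 0 < ((n : ℝ) + c) ^ (-c) := by positivity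
    rw [abs_of_pos h8, Real.rpow_one]
    field_simp
  refine summable_of_isBigO_nat hs ?_
  simp_rw [e]
  have h1 := ((Wc_asymp hc).inv₀ one_ne_zero).isBigO_one ℝ
  simpa using! h1.mul (Asymptotics.isBigO_refl (fun n : ℕ => Wc c n * ((n : ℝ) + c) ^ (-c)) atTop)

/-- The truncated test sequence. -/
noncomputable def testSeq (α c s : ℝ) (L m : ℕ) : ℂ :=
  if m < L then ((poch m α * ((m : ℝ) + c) ^ (-s) : ℝ) : ℂ) else 0

lemma poch_pos {γ s : ℝ} (h1 : 0 < γ + 1) (h2 : 0 < γ + s + 1) : 0 < poch γ s :=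
  div_pos (Real.Gamma_pos_of_pos h2) (Real.Gamma_pos_of_pos h1)

lemma poch_beta {β : ℝ} (n : ℕ) : poch n β = Wc (β + 1) n := by
  rw [poch, Wc, Real.Gamma_nat_eq_factorial, add_assoc]

lemma kker_eq {α β : ℝ} (hα : -1 < α) (hβ : -1 < β) (hβα : -1 < β - α) (m n : ℕ) :
    kker α β m n * poch m α = poch ((n : ℝ) + β - α) α * nbc (n + (β + 1)) m := by
  have hm : (0 : ℝ) ≤ m := Nat.cast_nonneg m
  have hn : (0 : ℝ) ≤ n := Nat.cast_nonneg n
  have h1 : 0 < Real.Gamma ((m : ℝ) + α + 1) := Real.Gamma_pos_of_pos (by linarith)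
  have h2 : 0 < Real.Gamma ((n : ℝ) + β - α + 1) := Real.Gamma_pos_of_pos (by linarith)
  have h3 : 0 < Real.Gamma ((n : ℝ) + (β + 1)) := Real.Gamma_pos_of_pos (by linarith)
  rw [kker, poch, poch, nbc, Real.Gamma_nat_eq_factorial,
    show (n : ℝ) + β - α + α + 1 = n + (β + 1) by ring,
    show (n : ℝ) + m + β + 1 = m + (n + (β + 1)) by ring]
  field_simp

lemma w1_test {p α β s : ℝ} (hp : 1 ≤ p) (hα : -1 < α) (hβ : -1 < β) (L m : ℕ) :
    w1 α β p m * ‖testSeq α (β + 1) s L m‖ ^ p =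
      if m < L then Wc (β + 1) m * ((m : ℝ) + (β + 1)) ^ (-(s * p)) else 0 := by
  have hm : (0 : ℝ) ≤ m := Nat.cast_nonneg m
  unfold testSeq
  split_ifs with h
  · have hP : 0 < poch m α := poch_pos (by linarith) (by linarith)
    have hx : 0 < (m : ℝ) + (β + 1) := by linarith
    rw [Complex.norm_real, Real.norm_of_nonneg (by positivity), w1, poch_beta (β := β),
      Real.mul_rpow hP.le (by positivity), ← Real.rpow_mul hx.le, Real.rpow_neg hP.le]
    have : 0 < poch m α ^ p := by positivity
    rw [neg_mul]
    field_simp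
  · rw [norm_zero, Real.zero_rpow (by linarith), mul_zero]

/-- The truncated (normalised) output. -/
noncomputable def Yt (μ : Measure ℝ) (c s : ℝ) (L n : ℕ) : ℝ :=
  ∑ m ∈ Finset.range L, nbc (n + c) m * ((m : ℝ) + c) ^ (-s) *
    ∫ t in Ioo (0 : ℝ) 1, t ^ m * (1 - t) ^ n ∂μ

lemma Hab_test (μ : Measure ℝ) {α β s : ℝ} (hα : -1 < α) (hβ : -1 < β)
    (hβα : -1 < β - α) (L n : ℕ) :
    Hab μ α β (testSeq α (β + 1) s L) n =
      ((poch ((n : ℝ) + β - α) α * Yt μ (β + 1) s L n : ℝ) : ℂ) := by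
  unfold Hab
  rw [tsum_eq_sum (s := Finset.range L)]
  · rw [Yt, Finset.mul_sum, Complex.ofReal_sum]
    refine Finset.sum_congr rfl fun m hm => ?_
    have hm' := Finset.mem_range.1 hm
    simp only [testSeq, hm', if_true]
    rw [integral_smul_const]
    simp_rw [mul_assoc (kker α β m n)]
    rw [integral_const_mul, Complex.real_smul, ← Complex.ofReal_mul]
    congr 1
    have := kker_eq hα hβ hβα m n
    linear_combination ((m : ℝ) + (β + 1)) ^ (-s) *
      (∫ t in Ioo (0 : ℝ) 1, t ^ m * (1 - t) ^ n ∂μ) * this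
  · intro m hm
    have hm' : ¬ m < L := by simpa using hm
    simp [testSeq, hm']

lemma integral_mono_nonneg (μ : Measure ℝ) (m n : ℕ) :
    0 ≤ ∫ t in Ioo (0 : ℝ) 1, t ^ m * (1 - t) ^ n ∂μ := by
  refine setIntegral_nonneg measurableSet_Ioo fun t ht => ?_
  have h1 := ht.1
  have h2 : 0 < 1 - t := by linarith [ht.2]
  positivity

lemma Yt_nonneg (μ : Measure ℝ) {c s : ℝ} (hc : 0 < c) (L n : ℕ) : 0 ≤ Yt μ c s L n := by
  refine Finset.sum_nonneg fun m _ => ?_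
  have h1 := nbc_pos (r := n + c) (by positivity) m
  have h2 := integral_mono_nonneg μ m n
  positivity

lemma w2_test (μ : Measure ℝ) {p α β s : ℝ} (hα : -1 < α) (hβ : -1 < β)
    (hβα : -1 < β - α) (L n : ℕ) :
    w2 α β p n * ‖Hab μ α β (testSeq α (β + 1) s L) n‖ ^ p =
      Wc (β + 1) n * Yt μ (β + 1) s L n ^ p := by
  have hn : (0 : ℝ) ≤ n := Nat.cast_nonneg n
  have hP : 0 < poch ((n : ℝ) + β - α) α := poch_pos (by linarith) (by linarith)
  have hY := Yt_nonneg μ (s := s) (show 0 < β + 1 by linarith) L n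
  rw [Hab_test μ hα hβ hβα, Complex.norm_real, Real.norm_of_nonneg (by positivity), w2, poch_beta (β := β),
    Real.mul_rpow hP.le hY, Real.rpow_neg hP.le]
  have : 0 < poch ((n : ℝ) + β - α) α ^ p := by positivity
  field_simp

/-- The full (normalised) output, as an extended nonnegative real. -/
noncomputable def Yf (μ : Measure ℝ) (c s : ℝ) (n : ℕ) : ℝ≥0∞ :=
  ∫⁻ t in Ioo (0 : ℝ) 1, ∑' m : ℕ,
    ENNReal.ofReal (nbc (n + c) m * ((m : ℝ) + c) ^ (-s) * (t ^ m * (1 - t) ^ n)) ∂μ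

lemma Yt_tendsto (μ : Measure ℝ) [IsFiniteMeasure μ] {c s : ℝ} (hc : 0 < c) (n : ℕ) :
    Tendsto (fun L => ENNReal.ofReal (Yt μ c s L n)) atTop (𝓝 (Yf μ c s n)) := by
  unfold Yf
  rw [lintegral_tsum (fun m => by fun_prop)]
  refine (ENNReal.tendsto_nat_tsum _).congr fun L => ?_
  have hnb : ∀ m, 0 < nbc (n + c) m := fun m => nbc_pos (by positivity) m
  rw [Yt, ENNReal.ofReal_sum_of_nonneg]
  · refine Finset.sum_congr rfl fun m _ => ?_
    rw [← integral_const_mul, ofReal_integral_eq_lintegral_ofReal]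
    · refine Integrable.of_bound (C := nbc (n + c) m * ((m : ℝ) + c) ^ (-s))
        (by fun_prop) ?_
      filter_upwards [ae_restrict_mem measurableSet_Ioo] with t ht
      have h1 := ht.1
      have h2 : 0 < 1 - t := by linarith [ht.2]
      have h3 := hnb m
      rw [Real.norm_of_nonneg (by positivity)]
      have h4 : t ^ m * (1 - t) ^ n ≤ 1 :=
        mul_le_one₀ (pow_le_one₀ h1.le ht.2.le) (by positivity)
          (pow_le_one₀ h2.le (by linarith))
      exact mul_le_of_le_one_right (by positivity) h4
    · filter_upwards [ae_restrict_mem measurableSet_Ioo] with t ht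
      have h1 := ht.1
      have h2 : 0 < 1 - t := by linarith [ht.2]
      have h3 := hnb m
      simp only [Pi.zero_apply]
      positivity
  · intro m _
    have h1 := hnb m
    have h2 := integral_mono_nonneg μ m n
    positivity

lemma Yf_bound (μ : Measure ℝ) [IsFiniteMeasure μ] {p α β : ℝ}
    (hp : 1 ≤ p) (hα : -1 < α) (hβ : -1 < β) (hβα : -1 < β - α) {M : ℝ}
    (hM : ∀ a : ℕ → ℂ, Summable (fun m : ℕ => w1 α β p m * ‖a m‖ ^ p) →
        ∑' n : ℕ, ENNReal.ofReal (w2 α β p n * ‖Hab μ α β a n‖ ^ p) ≤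
          ENNReal.ofReal M ^ p * ∑' m : ℕ, ENNReal.ofReal (w1 α β p m * ‖a m‖ ^ p)) (s : ℝ) :
    ∑' n : ℕ, ENNReal.ofReal (Wc (β + 1) n) * Yf μ (β + 1) s n ^ p ≤
      ENNReal.ofReal M ^ p *
        ∑' n : ℕ, ENNReal.ofReal (Wc (β + 1) n * ((n : ℝ) + (β + 1)) ^ (-(s * p))) := by
  have hc : 0 < β + 1 := by linarith
  have key : ∀ L : ℕ, ∑' n : ℕ, ENNReal.ofReal (Wc (β + 1) n) *
      ENNReal.ofReal (Yt μ (β + 1) s L n) ^ p ≤ ENNReal.ofReal M ^ p *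
        ∑' n : ℕ, ENNReal.ofReal (Wc (β + 1) n * ((n : ℝ) + (β + 1)) ^ (-(s * p))) := by
    intro L
    have h := hM (testSeq α (β + 1) s L) (by
      refine summable_of_ne_finset_zero (s := Finset.range L) fun m hm => ?_
      rw [w1_test hp hα hβ, if_neg (by simpa using hm)])
    simp_rw [w2_test μ hα hβ hβα, w1_test hp hα hβ] at h
    refine le_trans (le_of_eq ?_) (h.trans ?_)
    · congr 1
      ext n
      rw [ENNReal.ofReal_mul (Wc_pos hc n).le,
        ENNReal.ofReal_rpow_of_nonneg (Yt_nonneg μ hc L n) (by linarith)]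
    · gcongr with m
      split_ifs
      · exact le_rfl
      · have := Wc_pos hc m
        positivity
  rw [ENNReal.tsum_eq_iSup_nat]
  refine iSup_le fun K => ?_
  have hT : Tendsto (fun L => ∑ n ∈ Finset.range K, ENNReal.ofReal (Wc (β + 1) n) *
      ENNReal.ofReal (Yt μ (β + 1) s L n) ^ p) atTop
      (𝓝 (∑ n ∈ Finset.range K, ENNReal.ofReal (Wc (β + 1) n) * Yf μ (β + 1) s n ^ p)) := by
    refine tendsto_finsetSum _ fun n _ => ?_
    refine ENNReal.Tendsto.const_mul ?_ (Or.inr ENNReal.ofReal_ne_top)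
    exact ((ENNReal.continuous_rpow_const).tendsto _).comp (Yt_tendsto μ hc n)
  exact le_of_tendsto' hT fun L => (ENNReal.sum_le_tsum _).trans (key L)

lemma fatou_ofReal (μ : Measure ℝ) {f : ℕ → ℝ → ℝ} {g : ℝ → ℝ} (hmeas : ∀ k, Measurable (f k))
    (hlim : ∀ t ∈ Ioo (0 : ℝ) 1, Tendsto (fun k => f k t) atTop (𝓝 (g t)))
    {B : ℕ → ℝ≥0∞} {b : ℝ≥0∞} (hB : Tendsto B atTop (𝓝 b))
    (hle : ∀ k, ∫⁻ t in Ioo (0 : ℝ) 1, ENNReal.ofReal (f k t) ∂μ ≤ B k) :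
    ∫⁻ t in Ioo (0 : ℝ) 1, ENNReal.ofReal (g t) ∂μ ≤ b := by
  have h1 : ∫⁻ t in Ioo (0 : ℝ) 1, ENNReal.ofReal (g t) ∂μ =
      ∫⁻ t in Ioo (0 : ℝ) 1, liminf (fun k => ENNReal.ofReal (f k t)) atTop ∂μ := by
    refine setLIntegral_congr_fun measurableSet_Ioo fun t ht => ?_
    exact ((ENNReal.continuous_ofReal.tendsto _).comp (hlim t ht)).liminf_eq.symm
  rw [h1]
  refine (lintegral_liminf_le fun k => (hmeas k).ennreal_ofReal).trans ?_
  rw [← hB.liminf_eq]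
  exact liminf_le_liminf (Eventually.of_forall hle)

/-- The approximating constants. -/
noncomputable def AN (μ : Measure ℝ) (c s : ℝ) (N : ℕ) : ℝ≥0∞ :=
  ∫⁻ t in Ioo (0 : ℝ) 1,
    ENNReal.ofReal ((1 - t) ^ (s - c) * ((N * t + c) / (N + c)) ^ (-s)) ∂μ

lemma AN_le_Yf (μ : Measure ℝ) {c s : ℝ} (hc : 0 < c) (hs : 0 < s) {N n : ℕ} (hn : N ≤ n) :
    ENNReal.ofReal (((n : ℝ) + c) ^ (-s)) * AN μ c s N ≤ Yf μ c s n := by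
  unfold AN Yf
  rw [← lintegral_const_mul' _ _ ENNReal.ofReal_ne_top]
  refine setLIntegral_mono' measurableSet_Ioo fun t ht => ?_
  have ht0 := ht.1
  have h2 : 0 < 1 - t := by linarith [ht.2]
  refine le_trans ?_ (jensen_nbc n hc ht0 ht.2 hs)
  rw [← ENNReal.ofReal_mul (by positivity)]
  apply ENNReal.ofReal_le_ofReal
  have hnN : (N : ℝ) ≤ n := by exact_mod_cast hn
  have hN0 : (0 : ℝ) < N + c := by positivity
  have hn0 : (0 : ℝ) < n + c := by positivity
  have h3 : (n * t + c) ≤ (n + c) * ((N * t + c) / (N + c)) := by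
    rw [mul_div_assoc', le_div_iff₀ hN0]
    nlinarith [mul_nonneg (mul_nonneg (sub_nonneg.2 hnN) hc.le) h2.le]
  have h4 : ((n + c) * ((N * t + c) / (N + c))) ^ (-s) ≤ (n * t + c) ^ (-s) :=
    Real.rpow_le_rpow_of_nonpos (by positivity) h3 (by linarith)
  rw [Real.mul_rpow hn0.le (by positivity)] at h4
  calc _ = (1 - t) ^ (s - c) * (((n : ℝ) + c) ^ (-s) * ((N * t + c) / (N + c)) ^ (-s)) := by ring
    _ ≤ _ := by gcongr

/-- The terms of the norm of the test sequence. -/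
noncomputable def St (c p s : ℝ) (n : ℕ) : ℝ≥0∞ :=
  ENNReal.ofReal (Wc c n * ((n : ℝ) + c) ^ (-(s * p)))

lemma AN_bound (μ : Measure ℝ) {c p s : ℝ} (hp : 1 ≤ p) (hc : 0 < c) (hs : 0 < s)
    {m : ℝ≥0∞} (h : ∑' n : ℕ, ENNReal.ofReal (Wc c n) * Yf μ c s n ^ p ≤ m * ∑' n, St c p s n)
    (N : ℕ) :
    AN μ c s N ^ p * ∑' n, St c p s (n + N) ≤
      m * ((∑ n ∈ Finset.range N, St c p s n) + ∑' n, St c p s (n + N)) := by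
  have hsplit : (∑ n ∈ Finset.range N, St c p s n) + ∑' n, St c p s (n + N) = ∑' n, St c p s n :=
    ENNReal.summable.sum_add_tsum_nat_add' 
  rw [hsplit]
  refine le_trans ?_ h
  have h1 : ∑' n : ℕ, ENNReal.ofReal (Wc c (n + N)) * Yf μ c s (n + N) ^ p ≤
      ∑' n : ℕ, ENNReal.ofReal (Wc c n) * Yf μ c s n ^ p :=
    ENNReal.tsum_comp_le_tsum_of_injective (add_left_injective N)
      (fun n : ℕ => ENNReal.ofReal (Wc c n) * Yf μ c s n ^ p)
  refine le_trans ?_ h1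
  rw [← ENNReal.tsum_mul_left]
  refine ENNReal.tsum_le_tsum fun n => ?_
  have h2 := AN_le_Yf μ hc hs (N := N) (n := n + N) (by omega)
  have h3 := ENNReal.rpow_le_rpow h2 (by linarith : (0 : ℝ) ≤ p)
  have hx : (0 : ℝ) < ((n + N : ℕ) : ℝ) + c := by positivity
  rw [ENNReal.mul_rpow_of_nonneg _ _ (by linarith),
    ENNReal.ofReal_rpow_of_nonneg (by positivity) (by linarith), ← Real.rpow_mul hx.le,
    neg_mul] at h3
  rw [St, ENNReal.ofReal_mul (Wc_pos hc _).le]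
  calc _ = ENNReal.ofReal (Wc c (n + N)) * (ENNReal.ofReal (((n + N : ℕ) + c) ^ (-(s * p))) *
          AN μ c s N ^ p) := by ring
    _ ≤ _ := by gcongr

lemma St_tail_tendsto {c p : ℝ} (hp : 1 ≤ p) (hc : 0 < c) (N : ℕ) {s : ℕ → ℝ}
    (hs : Tendsto s atTop (𝓝 (c / p))) :
    Tendsto (fun k => ∑' n, St c p (s k) (n + N)) atTop (𝓝 ⊤) := by
  have hcont : ∀ n, Tendsto (fun k => St c p (s k) n) atTop (𝓝 (St c p (c / p) n)) := by
    intro n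
    refine (ENNReal.continuous_ofReal.tendsto _).comp ?_
    refine Tendsto.const_mul _ ?_
    exact Tendsto.rpow tendsto_const_nhds ((hs.mul_const p).neg) (Or.inl (by positivity))
  have htop : ∑' n, St c p (c / p) (n + N) = ⊤ := by
    by_contra hne
    apply not_summable_Wc hc
    rw [← summable_nat_add_iff N]
    have h := ENNReal.summable_toReal hne
    refine h.congr fun n => ?_
    have := Wc_pos hc (n + N)
    have e : c / p * p = c := by field_simp
    rw [St, ENNReal.toReal_ofReal (by positivity), e]
  rw [ENNReal.tendsto_nhds_top_iff_nat]
  intro b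
  have h1 := ENNReal.tendsto_nat_tsum (fun n => St c p (c / p) (n + N))
  rw [htop] at h1
  obtain ⟨K, hK⟩ := ((ENNReal.tendsto_nhds_top_iff_nat.1 h1) b).exists
  have h2 : Tendsto (fun k => ∑ n ∈ Finset.range K, St c p (s k) (n + N)) atTop
      (𝓝 (∑ n ∈ Finset.range K, St c p (c / p) (n + N))) :=
    tendsto_finsetSum _ fun n _ => hcont (n + N)
  filter_upwards [h2.eventually_const_lt hK] with k hk
  exact hk.trans_le (ENNReal.sum_le_tsum _)

lemma AN_limit_bound (μ : Measure ℝ) {c p : ℝ} (hp : 1 ≤ p) (hc : 0 < c) {M : ℝ}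
    (h : ∀ s, ∑' n : ℕ, ENNReal.ofReal (Wc c n) * Yf μ c s n ^ p ≤
      ENNReal.ofReal M ^ p * ∑' n, St c p s n) (N : ℕ) :
    AN μ c (c / p) N ≤ ENNReal.ofReal M := by
  have hp0 : 0 < p := by linarith
  set s : ℕ → ℝ := fun k => c / p + 1 / ((k : ℝ) + 1) with hsdef
  have hslim : Tendsto s atTop (𝓝 (c / p)) := by
    have h0 := (tendsto_one_div_add_atTop_nhds_zero_nat (𝕜 := ℝ)).const_add (c / p)
    rwa [add_zero] at h0
  have hspos : ∀ k, 0 < s k := fun k => by positivity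
  set T : ℕ → ℝ≥0∞ := fun k => ∑' n, St c p (s k) (n + N) with hT
  set Hd : ℕ → ℝ≥0∞ := fun k => ∑ n ∈ Finset.range N, St c p (s k) n with hHd
  have hTlim : Tendsto T atTop (𝓝 ⊤) := St_tail_tendsto hp hc N hslim
  have hHlim : Tendsto Hd atTop (𝓝 (∑ n ∈ Finset.range N, St c p (c / p) n)) := by
    refine tendsto_finsetSum _ fun n _ => ?_
    refine (ENNReal.continuous_ofReal.tendsto _).comp ?_
    refine Tendsto.const_mul _ ?_
    exact Tendsto.rpow tendsto_const_nhds ((hslim.mul_const p).neg) (Or.inl (by positivity))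
  have hHfin : (∑ n ∈ Finset.range N, St c p (c / p) n) ≠ ⊤ :=
    ENNReal.sum_ne_top.2 fun n _ => ENNReal.ofReal_ne_top
  have hratio : Tendsto (fun k => Hd k / T k) atTop (𝓝 0) := by
    have := ENNReal.Tendsto.div hHlim (Or.inr (by simp)) hTlim (Or.inr hHfin)
    simpa using this
  have hT0 : ∀ k, T k ≠ 0 := by
    intro k h0
    have := ENNReal.tsum_eq_zero.1 h0 0
    rw [St, ENNReal.ofReal_eq_zero] at this
    have h1 := Wc_pos hc (0 + N)
    have h2 : 0 < Wc c (0 + N) * (((0 + N : ℕ) : ℝ) + c) ^ (-(s k * p)) := by positivity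
    linarith
  have hTtop : ∀ k, T k ≠ ⊤ := by
    intro k
    have hk : 0 < 1 / ((k : ℝ) + 1) * p := by positivity
    have hsum := summable_Wc hc hk
    have e : c + 1 / ((k : ℝ) + 1) * p = s k * p := by
      rw [hsdef]; field_simp
    rw [e, ← summable_nat_add_iff N] at hsum
    exact hsum.tsum_ofReal_ne_top
  have hb : ∀ k, AN μ c (s k) N ≤ ENNReal.ofReal M * (Hd k / T k + 1) ^ (1 / p) := by
    intro k
    have h1 := AN_bound μ hp hc (hspos k) (h (s k)) N
    have h2 : AN μ c (s k) N ^ p ≤ ENNReal.ofReal M ^ p * (Hd k / T k + 1) := by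
      have h3 := (ENNReal.le_div_iff_mul_le (Or.inl (hT0 k)) (Or.inl (hTtop k))).2 h1
      refine h3.trans (le_of_eq ?_)
      rw [mul_div_assoc, ENNReal.add_div, ENNReal.div_self (hT0 k) (hTtop k)]
    have h4 := ENNReal.rpow_le_rpow h2 (by positivity : (0 : ℝ) ≤ 1 / p)
    rwa [ENNReal.mul_rpow_of_nonneg _ _ (by positivity), ← ENNReal.rpow_mul, ← ENNReal.rpow_mul,
      mul_one_div_cancel hp0.ne', ENNReal.rpow_one, ENNReal.rpow_one] at h4
  have hBlim : Tendsto (fun k => ENNReal.ofReal M * (Hd k / T k + 1) ^ (1 / p)) atTop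
      (𝓝 (ENNReal.ofReal M)) := by
    have h1 : Tendsto (fun k => Hd k / T k + 1) atTop (𝓝 1) := by
      simpa using hratio.add_const 1
    have h2 := ((ENNReal.continuous_rpow_const (y := 1 / p)).tendsto 1).comp h1
    have h3 := ENNReal.Tendsto.const_mul (a := ENNReal.ofReal M) h2 (Or.inr ENNReal.ofReal_ne_top)
    simpa using h3
  refine fatou_ofReal μ (f := fun k t => (1 - t) ^ (s k - c) * ((N * t + c) / (N + c)) ^ (-(s k)))
    (fun k => by fun_prop) ?_ hBlim hb
  intro t ht
  have ht0 := ht.1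
  have h2 : 0 < 1 - t := by linarith [ht.2]
  refine Tendsto.mul ?_ ?_
  · exact Tendsto.rpow tendsto_const_nhds (hslim.sub_const c) (Or.inl h2.ne')
  · exact Tendsto.rpow tendsto_const_nhds hslim.neg (Or.inl (by positivity))

lemma C_bound (μ : Measure ℝ) {c p : ℝ} (hp : 1 ≤ p) (hc : 0 < c) {M : ℝ}
    (h : ∀ s, ∑' n : ℕ, ENNReal.ofReal (Wc c n) * Yf μ c s n ^ p ≤
      ENNReal.ofReal M ^ p * ∑' n, St c p s n) :
    ∫⁻ t in Ioo (0 : ℝ) 1, ENNReal.ofReal ((1 - t) ^ (-(1 - 1 / p) * c) * t ^ (-(c / p))) ∂μ ≤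
      ENNReal.ofReal M := by
  refine fatou_ofReal μ
    (f := fun (N : ℕ) t => (1 - t) ^ (c / p - c) * ((N * t + c) / (N + c)) ^ (-(c / p)))
    (fun k => by fun_prop) ?_ tendsto_const_nhds (AN_limit_bound μ hp hc h)
  intro t ht
  have e : -(1 - 1 / p) * c = c / p - c := by ring
  rw [e]
  refine Tendsto.const_mul _ ?_
  refine Tendsto.rpow_const ?_ (Or.inl ht.1.ne')
  have h2 : Tendsto (fun n : ℕ => (n : ℝ) / (n + c)) atTop (𝓝 1) :=
    tendsto_natCast_div_add_atTop c
  have h3 : Tendsto (fun n : ℕ => t * ((n : ℝ) / (n + c)) + (1 - (n : ℝ) / (n + c))) atTop (𝓝 t) := by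
    have := (h2.const_mul t).add (h2.const_sub 1)
    simpa using this
  refine h3.congr fun n => ?_
  have : (n : ℝ) + c ≠ 0 := by positivity
  field_simp
  ring

/-- If `H_μ^{α,β} : ℓ^p_{w₁} → ℓ^p_{w₂}` is bounded, then
`C_μ(β,p) = ∫_{(0,1)} (1-t)^{-(1-1/p)(β+1)} t^{-(β+1)/p} dμ(t)` is finite and every bound
`M` for the operator satisfies `M ≥ C_μ(β,p)` (i.e. the operator norm is at least
`C_μ(β,p)`). -/
theorem Hab_norm_ge (μ : Measure ℝ) [IsFiniteMeasure μ] (p α β : ℝ)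
    (hp : 1 ≤ p) (hα : -1 < α) (hβ : -1 < β) (hβα : -1 < β - α)
    (hbdd : ∃ M : ℝ, 0 ≤ M ∧ ∀ a : ℕ → ℂ,
      Summable (fun m : ℕ => w1 α β p m * ‖a m‖ ^ p) →
      ∑' n : ℕ, ENNReal.ofReal (w2 α β p n * ‖Hab μ α β a n‖ ^ p) ≤
        ENNReal.ofReal M ^ p * ∑' m : ℕ, ENNReal.ofReal (w1 α β p m * ‖a m‖ ^ p)) :
    (∫⁻ t in Ioo (0 : ℝ) 1,
        ENNReal.ofReal ((1 - t) ^ (-(1 - 1 / p) * (β + 1)) * t ^ (-((β + 1) / p))) ∂μ) ≠ ⊤ ∧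
    ∀ M : ℝ, 0 ≤ M →
      (∀ a : ℕ → ℂ, Summable (fun m : ℕ => w1 α β p m * ‖a m‖ ^ p) →
        ∑' n : ℕ, ENNReal.ofReal (w2 α β p n * ‖Hab μ α β a n‖ ^ p) ≤
          ENNReal.ofReal M ^ p * ∑' m : ℕ, ENNReal.ofReal (w1 α β p m * ‖a m‖ ^ p)) →
      (∫⁻ t in Ioo (0 : ℝ) 1,
          ENNReal.ofReal ((1 - t) ^ (-(1 - 1 / p) * (β + 1)) *
            t ^ (-((β + 1) / p))) ∂μ) ≤ ENNReal.ofReal M := by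

  have hc : 0 < β + 1 := by linarith
  have main : ∀ M : ℝ, 0 ≤ M →
      (∀ a : ℕ → ℂ, Summable (fun m : ℕ => w1 α β p m * ‖a m‖ ^ p) →
        ∑' n : ℕ, ENNReal.ofReal (w2 α β p n * ‖Hab μ α β a n‖ ^ p) ≤
          ENNReal.ofReal M ^ p * ∑' m : ℕ, ENNReal.ofReal (w1 α β p m * ‖a m‖ ^ p)) →
      (∫⁻ t in Ioo (0 : ℝ) 1,
          ENNReal.ofReal ((1 - t) ^ (-(1 - 1 / p) * (β + 1)) *
            t ^ (-((β + 1) / p))) ∂μ) ≤ ENNReal.ofReal M := fun M _ hM =>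
    C_bound μ hp hc (fun s => Yf_bound μ hp hα hβ hβα hM s)
  refine ⟨?_, main⟩
  obtain ⟨M, hM0, hM⟩ := hbdd
  exact ne_top_of_le_ne_top ENNReal.ofReal_ne_top (main M hM0 hM)
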